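/- Let λ > 0 and let f be a nonnegative C^∞ function on (0,∞). Then λf(x) + x f'(x) is completely monotonic if and only if f(x) = α + β x^{-λ} + ∫₀^∞ e^{-xs} s^{λ-1} (∫_s^∞ t^{-λ} dμ(t)) ds for some α, β ≥ 0 and positive measure μ on (0,∞) making the integral convergent. -/

import Mathlib

open Real Set MeasureTheory

/-- A function is completely monotonic on `(0, ∞)`. -/
def CompletelyMonotonic (φ : ℝ → ℝ) : Prop :=
  ContDiffOn ℝ (⊤ : ℕ∞) φ (Set.Ioi 0) ∧
    ∀ n : ℕ, ∀ x : ℝ, 0 < x → 0 ≤ (-1 : ℝ) ^ n * iteratedDerivWithin n φ (Set.Ioi 0) x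

section

open Filter ProbabilityTheory
open scoped Nat Topology

theorem hasDerivAt_taylorSum {D : ℕ → ℝ → ℝ} {y : ℝ}
    (hD : ∀ n, HasDerivAt (D n) (D (n + 1) y) y) (x : ℝ) (n : ℕ) :
    HasDerivAt (fun z => ∑ k ∈ Finset.range (n + 1), D k z / k ! * (x - z) ^ k)
      (D (n + 1) y / n ! * (x - y) ^ n) y := by
  induction n with
  | zero => simpa using hD 0
  | succ n ih =>
    simp_rw [Finset.sum_range_succ _ (n + 1)]
    have h1 : HasDerivAt (fun z : ℝ => (x - z) ^ (n + 1)) ((n + 1 : ℕ) * (x - y) ^ n * (-1)) y := by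
      simpa using ((hasDerivAt_id y).const_sub x).fun_pow (n + 1)
    refine (ih.fun_add (((hD (n + 1)).div_const ((n + 1)! : ℝ)).fun_mul h1)).congr_deriv ?_
    have : (n ! : ℝ) ≠ 0 := by positivity
    rw [Nat.factorial_succ]
    push_cast
    field_simp
    ring

theorem taylorSum_le {D : ℕ → ℝ → ℝ} {R : ℝ} (hD : ∀ n, ∀ y < R, HasDerivAt (D n) (D (n + 1) y) y)
    (hD0 : ∀ n, ∀ y < R, 0 ≤ D n y) {x y : ℝ} (hyx : y ≤ x) (hx : x < R) (n : ℕ) :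
    ∑ k ∈ Finset.range (n + 1), D k y / k ! * (x - y) ^ k ≤ D 0 x := by
  have hderiv : ∀ z ∈ Iic x, HasDerivAt
      (fun z => ∑ k ∈ Finset.range (n + 1), D k z / k ! * (x - z) ^ k)
      (D (n + 1) z / n ! * (x - z) ^ n) z := fun z hz =>
    hasDerivAt_taylorSum (fun n => hD n z (lt_of_le_of_lt hz hx)) x n
  have hmono : MonotoneOn (fun z => ∑ k ∈ Finset.range (n + 1), D k z / k ! * (x - z) ^ k)
      (Iic x) := by
    refine monotoneOn_of_deriv_nonneg (convex_Iic x)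
      (fun z hz => (hderiv z hz).continuousAt.continuousWithinAt)
      (fun z hz => (hderiv z (interior_subset hz)).differentiableAt.differentiableWithinAt)
      fun z hz => ?_
    have hz' := interior_subset hz
    rw [(hderiv z hz').deriv]
    have := hD0 (n + 1) z (lt_of_le_of_lt hz' hx)
    have : 0 ≤ x - z := sub_nonneg.2 hz'
    positivity
  refine (hmono (mem_Iic.2 hyx) (mem_Iic.2 le_rfl) hyx).trans_eq ?_
  simp [Finset.sum_range_succ']

/-- **Bernstein's little theorem**: absolutely monotone functions are sums of their Taylor
series. -/
theorem hasSum_taylor_of_derivatives_nonneg {D : ℕ → ℝ → ℝ} {R : ℝ}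
    (hD : ∀ n, ∀ y < R, HasDerivAt (D n) (D (n + 1) y) y)
    (hD0 : ∀ n, ∀ y < R, 0 ≤ D n y) {x : ℝ} (hx0 : 0 ≤ x) (hx : x < R) :
    HasSum (fun k => D k 0 / k ! * x ^ k) (D 0 x) := by
  have hR : 0 < R := hx0.trans_lt hx
  rw [hasSum_iff_tendsto_nat_of_nonneg
    fun k => mul_nonneg (div_nonneg (hD0 k 0 hR) (by positivity)) (by positivity),
    ← tendsto_add_atTop_iff_nat 1]
  obtain ⟨S, hxS, hSR⟩ := exists_between hx
  have hS : 0 < S := hx0.trans_lt hxS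
  have hbound : ∀ n : ℕ, D 0 x - D 1 S * x * (x / S) ^ n ≤
      ∑ k ∈ Finset.range (n + 1), D k 0 / k ! * x ^ k := by
    intro n
    rcases hx0.eq_or_lt with rfl | hxpos
    · simp [Finset.sum_range_succ']
    obtain ⟨ξ, ⟨hξ0, hξx⟩, hξ⟩ := exists_hasDerivAt_eq_slope
      (fun z => ∑ k ∈ Finset.range (n + 1), D k z / k ! * (x - z) ^ k)
      (fun z => D (n + 1) z / n ! * (x - z) ^ n) hxpos
      (fun z hz => (hasDerivAt_taylorSum
        (fun n => hD n z (lt_of_le_of_lt hz.2 hx)) x n).continuousAt.continuousWithinAt)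
      (fun z hz => hasDerivAt_taylorSum (fun n => hD n z (hz.2.trans hx)) x n)
    have hself : ∑ k ∈ Finset.range (n + 1), D k x / k ! * (x - x) ^ k = D 0 x := by
      simp [Finset.sum_range_succ']
    rw [eq_div_iff (by linarith), hself] at hξ
    simp only [sub_zero] at hξ
    have hξR : ξ < R := hξx.trans hx
    have hle : D (n + 1) ξ / n ! * (S - ξ) ^ n ≤ D 1 S := by
      refine le_trans ?_ (taylorSum_le (D := fun k => D (k + 1)) (fun n => hD (n + 1))
        (fun n => hD0 (n + 1)) (hξx.trans hxS).le hSR n)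
      refine Finset.single_le_sum (f := fun k => D (k + 1) ξ / k ! * (S - ξ) ^ k)
        (fun k _ => ?_) (Finset.mem_range.2 n.lt_succ_self)
      have := hD0 (k + 1) ξ hξR
      have : 0 ≤ S - ξ := by linarith
      positivity
    have hratio : x - ξ ≤ x / S * (S - ξ) := by
      rw [div_mul_eq_mul_div, le_div_iff₀ hS]
      nlinarith
    have hmul : D (n + 1) ξ / n ! * (x - ξ) ^ n ≤ D 1 S * (x / S) ^ n := by
      calc D (n + 1) ξ / n ! * (x - ξ) ^ n
          ≤ D (n + 1) ξ / n ! * (x / S * (S - ξ)) ^ n := by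
            have := hD0 (n + 1) ξ hξR
            have : 0 ≤ x - ξ := by linarith
            gcongr
        _ = D (n + 1) ξ / n ! * (S - ξ) ^ n * (x / S) ^ n := by rw [mul_pow]; ring
        _ ≤ D 1 S * (x / S) ^ n := by gcongr
    nlinarith [mul_le_mul_of_nonneg_right hmul hx0]
  refine tendsto_of_tendsto_of_tendsto_of_le_of_le ?_ tendsto_const_nhds hbound fun n => ?_
  · have h0 : Tendsto (fun n : ℕ => (x / S) ^ n) atTop (𝓝 0) :=
      tendsto_pow_atTop_nhds_zero_of_lt_one (by positivity) ((div_lt_one hS).2 hxS)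
    simpa using (h0.const_mul (D 1 S * x)).const_sub (D 0 x)
  · simpa using taylorSum_le hD hD0 hx0 hx n

namespace CompletelyMonotonic

theorem hasDerivAt_iteratedDerivWithin {g : ℝ → ℝ} (hg : CompletelyMonotonic g) (n : ℕ) {y : ℝ}
    (hy : 0 < y) :
    HasDerivAt (iteratedDerivWithin n g (Ioi 0)) (iteratedDerivWithin (n + 1) g (Ioi 0) y) y := by
  have hd : DifferentiableOn ℝ (iteratedDerivWithin n g (Ioi 0)) (Ioi 0) :=
    hg.1.differentiableOn_iteratedDerivWithin (by exact_mod_cast WithTop.coe_lt_top _)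
      (uniqueDiffOn_Ioi 0)
  rw [iteratedDerivWithin_succ]
  exact (hd y hy).hasDerivWithinAt.hasDerivAt (Ioi_mem_nhds hy)

theorem hasSum_comp_affine {g : ℝ → ℝ} (hg : CompletelyMonotonic g) {ε θ s : ℝ} (hε : 0 < ε)
    (hθ : 0 < θ) (hs0 : 0 ≤ s) (hs1 : s ≤ 1) :
    HasSum (fun k => (-θ) ^ k * iteratedDerivWithin k g (Ioi 0) (ε + θ) / k ! * s ^ k)
      (g (ε + θ * (1 - s))) := by
  have hpos : ∀ y < 1 + ε / θ, 0 < ε + θ * (1 - y) := by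
    intro y hy
    have : (y - 1) * θ < ε := by rw [← lt_div_iff₀ hθ]; linarith
    linarith
  have h := hasSum_taylor_of_derivatives_nonneg (R := 1 + ε / θ) (x := s)
    (D := fun n y => (-θ) ^ n * iteratedDerivWithin n g (Ioi 0) (ε + θ * (1 - y)))
    (fun n y hy => ?_) (fun n y hy => ?_) hs0 (by have := div_pos hε hθ; linarith)
  · simpa using h
  · have hinner : HasDerivAt (fun y : ℝ => ε + θ * (1 - y)) (-θ) y := by
      simpa using (((hasDerivAt_id y).const_sub 1).const_mul θ).const_add ε
    refine (((hg.hasDerivAt_iteratedDerivWithin n (hpos y hy)).comp y hinner).const_mul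
      ((-θ) ^ n)).congr_deriv ?_
    ring
  · have h := hg.2 n _ (hpos y hy)
    rw [neg_pow, mul_right_comm]
    positivity

theorem exists_measure_integral_rpow_eq_comp {g : ℝ → ℝ} (hg : CompletelyMonotonic g) {ε θ : ℝ}
    (hε : 0 < ε) (hθ : 0 < θ) :
    ∃ ν : FiniteMeasure unitInterval, ∀ x : ℝ, 0 ≤ x →
      ∫ u, (u : ℝ) ^ x ∂(ν : Measure unitInterval) = g (ε + θ * (1 - exp (-(x / θ)))) := by
  set p : ℕ → ℝ := fun k => (-θ) ^ k * iteratedDerivWithin k g (Ioi 0) (ε + θ) / k ! with hp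
  have hp0 : ∀ k, 0 ≤ p k := by
    intro k
    have h := hg.2 k (ε + θ) (by linarith)
    simp only [hp]
    rw [neg_pow, mul_right_comm]
    positivity
  have hsum : ∀ s, 0 ≤ s → s ≤ 1 → HasSum (fun k => p k * s ^ k) (g (ε + θ * (1 - s))) :=
    fun s h0 h1 => hg.hasSum_comp_affine hε hθ h0 h1
  let a : ℕ → unitInterval := fun k => ⟨exp (-(k / θ)), (exp_pos _).le,
    exp_le_one_iff.2 (neg_nonpos.2 (by positivity))⟩
  let ν : Measure unitInterval :=
    Measure.sum fun k => ENNReal.ofReal (p k) • Measure.dirac (a k)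
  have hps : Summable p := by simpa using (hsum 1 zero_le_one le_rfl).summable
  have hfin : IsFiniteMeasure ν := by
    refine ⟨?_⟩
    simp only [ν, Measure.sum_apply _ MeasurableSet.univ, Measure.smul_apply, measure_univ,
      smul_eq_mul, mul_one]
    rw [← ENNReal.ofReal_tsum_of_nonneg hp0 hps]
    exact ENNReal.ofReal_lt_top
  refine ⟨⟨ν, hfin⟩, fun x hx => ?_⟩
  have hpow : ∀ k, ((a k : unitInterval) : ℝ) ^ x = exp (-(x / θ)) ^ k := by
    intro k
    simp only [a]
    rw [← Real.exp_mul, ← Real.exp_nat_mul]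
    congr 1
    ring
  have hs := hsum (exp (-(x / θ))) (exp_pos _).le (exp_le_one_iff.2 (neg_nonpos.2 (by positivity)))
  have := hasSum_integral_sum_dirac (x := a) (c := fun k => ENNReal.ofReal (p k))
    (f := fun u : unitInterval => (u : ℝ) ^ x) (fun _ => ENNReal.ofReal_ne_top) (by
      refine hs.summable.congr fun k => ?_
      rw [ENNReal.toReal_ofReal (hp0 k), hpow, norm_of_nonneg (by positivity)])
  refine this.unique ?_
  simpa only [ENNReal.toReal_ofReal (hp0 _), hpow, smul_eq_mul] using hs

theorem tendsto_mul_one_sub_exp (x : ℝ) :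
    Tendsto (fun n : ℕ => ((n : ℝ) + 1) * (1 - exp (-(x / ((n : ℝ) + 1))))) atTop (𝓝 x) := by
  have hd : HasDerivAt (fun t : ℝ => 1 - exp (-(x * t))) x 0 := by
    simpa using ((((hasDerivAt_id (0 : ℝ)).const_mul x).neg).exp).const_sub 1
  have := (hasDerivAt_iff_tendsto_slope_zero.1 hd).comp
    (tendsto_nhdsWithin_iff.2 ⟨tendsto_one_div_add_atTop_nhds_zero_nat (𝕜 := ℝ),
      Eventually.of_forall fun n => by simp; positivity⟩)
  refine this.congr fun n => ?_
  simp [div_eq_mul_inv]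

theorem exists_measure_integral_rpow_eq {g : ℝ → ℝ} (hg : CompletelyMonotonic g) {ε : ℝ}
    (hε : 0 < ε) :
    ∃ ν : FiniteMeasure unitInterval, ∀ x : ℝ, 0 ≤ x →
      ∫ u, (u : ℝ) ^ x ∂(ν : Measure unitInterval) = g (ε + x) := by
  choose M hM using fun n : ℕ =>
    hg.exists_measure_integral_rpow_eq_comp hε (θ := (n : ℝ) + 1) (by positivity)
  have hmass : ∀ n, (M n).mass ≤ (g ε).toNNReal := by
    intro n
    have := hM n 0 le_rfl
    have hm : ((M n).mass : ℝ) = g ε := by simpa using this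
    rw [← hm, Real.toNNReal_coe]
  obtain ⟨ν, -, hν⟩ := (isCompact_setOfPred_finiteMeasure_le_of_compactSpace unitInterval
    (g ε).toNNReal).ultrafilter_le_nhds' ((hyperfilter ℕ).map M)
    (Ultrafilter.mem_map.2 (univ_mem' hmass))
  have hν' : Tendsto M (hyperfilter ℕ) (𝓝 ν) := hν
  refine ⟨ν, fun x hx => ?_⟩
  have hcont : Continuous fun u : unitInterval => (u : ℝ) ^ x :=
    continuous_subtype_val.rpow_const fun _ => Or.inr hx
  have h1 := FiniteMeasure.tendsto_iff_forall_integral_tendsto.1 hν'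
    (BoundedContinuousFunction.mkOfCompact ⟨_, hcont⟩)
  simp only [BoundedContinuousFunction.mkOfCompact_apply, ContinuousMap.coe_mk, hM _ x hx] at h1
  have hgc : ContinuousAt g (ε + x) :=
    hg.1.continuousOn.continuousAt (Ioi_mem_nhds (by linarith))
  have h2 : Tendsto (fun n : ℕ => g (ε + ((n : ℝ) + 1) * (1 - exp (-(x / ((n : ℝ) + 1))))))
      atTop (𝓝 (g (ε + x))) :=
    hgc.tendsto.comp ((tendsto_mul_one_sub_exp x).const_add ε)
  exact tendsto_nhds_unique h1 (h2.mono_left (Nat.hyperfilter_le_atTop))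

end CompletelyMonotonic

theorem tendsto_integral_continuousMap {X ι : Type*} [TopologicalSpace X] [CompactSpace X]
    [MeasurableSpace X] [BorelSpace X] (μ : Measure X) [IsFiniteMeasure μ] {l : Filter ι}
    {F : ι → C(X, ℝ)} {f : C(X, ℝ)} (hF : Tendsto F l (𝓝 f)) :
    Tendsto (fun i => ∫ x, F i x ∂μ) l (𝓝 (∫ x, f x ∂μ)) := by
  have hfint : ∀ g : C(X, ℝ), Integrable g μ := fun g =>
    (BoundedContinuousFunction.mkOfCompact g).integrable μ
  rw [tendsto_iff_norm_sub_tendsto_zero] at hF ⊢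
  have h0 : Tendsto (fun i => μ.real univ * ‖F i - f‖) l (𝓝 0) := by
    simpa using hF.const_mul (μ.real univ)
  refine squeeze_zero (fun _ => norm_nonneg _) (fun i => ?_) h0
  have h := (BoundedContinuousFunction.mkOfCompact (F i - f)).norm_integral_le_mul_norm μ
  rw [BoundedContinuousFunction.norm_mkOfCompact] at h
  rw [← integral_sub (hfint _) (hfint _)]
  exact h

/-- Finite measures on the unit interval are determined by their moments. -/
theorem ext_of_moments {μ ν : Measure unitInterval} [IsFiniteMeasure μ] [IsFiniteMeasure ν]
    (h : ∀ n : ℕ, ∫ u, (u : ℝ) ^ n ∂μ = ∫ u, (u : ℝ) ^ n ∂ν) : μ = ν := by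
  have hpoly : ∀ p : Polynomial ℝ,
      ∫ u : unitInterval, p.eval (u : ℝ) ∂μ = ∫ u : unitInterval, p.eval (u : ℝ) ∂ν := by
    intro p
    have hfint : ∀ (ρ : Measure unitInterval) [IsFiniteMeasure ρ] (q : Polynomial ℝ),
        Integrable (fun u : unitInterval => q.eval (u : ℝ)) ρ := fun ρ _ q =>
      (BoundedContinuousFunction.mkOfCompact
        ⟨fun u : unitInterval => q.eval (u : ℝ), by fun_prop⟩).integrable ρ
    induction p using Polynomial.induction_on' with
    | add p q hp hq =>
      simp only [Polynomial.eval_add]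
      rw [integral_add (hfint μ p) (hfint μ q), integral_add (hfint ν p) (hfint ν q), hp, hq]
    | monomial n a =>
      simp only [Polynomial.eval_monomial]
      rw [integral_const_mul, integral_const_mul, h n]
  refine ext_of_forall_integral_eq_of_IsFiniteMeasure fun f => ?_
  have hclosed : f.toContinuousMap ∈ (polynomialFunctions unitInterval).topologicalClosure := by
    rw [polynomialFunctions_closure_eq_top']; trivial
  obtain ⟨F, hF, hFt⟩ := mem_closure_iff_seq_limit.1 hclosed
  have h1 := tendsto_integral_continuousMap μ hFt
  have h2 := tendsto_integral_continuousMap ν hFt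
  refine tendsto_nhds_unique h1 (h2.congr fun n => ?_)
  obtain ⟨p, -, hp⟩ := hF n
  rw [← hp]
  exact (hpoly p).symm

theorem withDensity_rpow_eq {g : ℝ → ℝ} {ε : ℝ} (hε : ε < 1)
    {μ ν : FiniteMeasure unitInterval}
    (hν : ∀ x, 0 ≤ x → ∫ u, (u : ℝ) ^ x ∂(ν : Measure unitInterval) = g (ε + x))
    (hμ : ∀ x, 0 ≤ x → ∫ u, (u : ℝ) ^ x ∂(μ : Measure unitInterval) = g (1 + x)) :
    (μ : Measure unitInterval) = (ν : Measure unitInterval).withDensity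
      fun u => ENNReal.ofReal ((u : ℝ) ^ (1 - ε)) := by
  have hcont : Continuous fun u : unitInterval => (u : ℝ) ^ (1 - ε) :=
    continuous_subtype_val.rpow_const fun _ => Or.inr (by linarith)
  have hi : Integrable (fun u : unitInterval => (u : ℝ) ^ (1 - ε)) (ν : Measure unitInterval) :=
    (BoundedContinuousFunction.mkOfCompact ⟨_, hcont⟩).integrable _
  have : IsFiniteMeasure ((ν : Measure unitInterval).withDensity
      fun u => ENNReal.ofReal ((u : ℝ) ^ (1 - ε))) :=
    isFiniteMeasure_withDensity_ofReal hi.2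
  refine ext_of_moments fun n => ?_
  have h1 := hμ n n.cast_nonneg
  have h2 := hν (1 - ε + n) (add_nonneg (by linarith) n.cast_nonneg)
  rw [integral_withDensity_eq_integral_toReal_smul (by fun_prop) (by simp)]
  simp only [rpow_natCast] at h1
  rw [h1, show 1 + (n:ℝ) = ε + (1 - ε + n) by ring, ← h2]
  refine integral_congr_ae (.of_forall fun u => ?_)
  have hu : 0 ≤ (u : ℝ) ^ (1 - ε) := rpow_nonneg u.2.1 _
  simp only [ENNReal.toReal_ofReal hu, smul_eq_mul]
  rw [rpow_add_of_nonneg u.2.1 (by linarith) n.cast_nonneg, rpow_natCast]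

/-- **Bernstein's theorem**: a completely monotonic function is the Laplace transform of a measure
on `[0, ∞)`. -/
theorem CompletelyMonotonic.exists_measure_lintegral_exp_eq {g : ℝ → ℝ}
    (hg : CompletelyMonotonic g) :
    ∃ ν : Measure ℝ, SFinite ν ∧ ν (Iio 0) = 0 ∧
      ∀ x, 0 < x → ∫⁻ t, ENNReal.ofReal (exp (-x * t)) ∂ν = ENNReal.ofReal (g x) := by
  obtain ⟨μ, hμ⟩ := hg.exists_measure_integral_rpow_eq one_pos
  have hpos : MeasurableSet {u : unitInterval | 0 < (u : ℝ)} :=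
    measurableSet_lt measurable_const measurable_subtype_coe
  have hm : Measurable fun u : unitInterval => -log (u : ℝ) :=
    (measurable_log.comp measurable_subtype_coe).neg
  refine ⟨(((μ : Measure unitInterval).restrict {u | 0 < (u : ℝ)}).withDensity
    fun u => ENNReal.ofReal (u : ℝ)⁻¹).map fun u : unitInterval => -log (u : ℝ),
    inferInstance, ?_, ?_⟩
  · rw [Measure.map_apply hm measurableSet_Iio]
    rw [show (fun u : unitInterval => -log (u : ℝ)) ⁻¹' Iio 0 = ∅ from ?_, measure_empty]
    ext u
    simpa using log_nonpos u.2.1 u.2.2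
  intro x hx
  set ε := min x 1 / 2 with hε
  have hmin : 0 < min x 1 := lt_min hx one_pos
  have hε0 : 0 < ε := by positivity
  have hε1 : ε < 1 := by linarith [min_le_right x 1]
  have hεx : ε < x := by linarith [min_le_left x 1]
  obtain ⟨ν, hν⟩ := hg.exists_measure_integral_rpow_eq hε0
  rw [lintegral_map (by fun_prop) hm,
    lintegral_withDensity_eq_lintegral_mul _ (by fun_prop) (by fun_prop),
    withDensity_rpow_eq hε1 hν hμ, restrict_withDensity hpos,
    lintegral_withDensity_eq_lintegral_mul _ (by fun_prop) (by fun_prop)]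
  have hcont : Continuous fun u : unitInterval => (u : ℝ) ^ (x - ε) :=
    continuous_subtype_val.rpow_const fun _ => Or.inr (by linarith)
  have hi : Integrable (fun u : unitInterval => (u : ℝ) ^ (x - ε)) (ν : Measure unitInterval) :=
    (BoundedContinuousFunction.mkOfCompact ⟨_, hcont⟩).integrable _
  have hx' := hν (x - ε) (by linarith)
  rw [show ε + (x - ε) = x by ring] at hx'
  rw [← hx', ofReal_integral_eq_lintegral_ofReal hi (.of_forall fun u => rpow_nonneg u.2.1 _),
    ← lintegral_indicator hpos]
  refine lintegral_congr fun u => ?_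
  rcases u.2.1.eq_or_lt with h0 | h0
  · rw [indicator_of_notMem (fun h => h.ne h0), ← h0, zero_rpow (by linarith)]
    simp
  · rw [indicator_of_mem (by exact h0)]
    simp only [Pi.mul_apply]
    rw [← ENNReal.ofReal_mul (by positivity), ← ENNReal.ofReal_mul (by positivity)]
    congr 1
    rw [neg_mul_neg, mul_comm x, ← rpow_def_of_pos h0, ← rpow_neg_one, ← rpow_add h0, ← rpow_add h0]
    congr 1
    ring

theorem lintegral_Ioo_comp_mul_right {t x : ℝ} (ht : 0 < t) (hx : 0 < x) (h : ℝ → ENNReal) :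
    ∫⁻ s in Ioo 0 t, h s = ∫⁻ u in Ioo 0 x, ENNReal.ofReal (t / x) * h (u * (t / x)) := by
  have hc : 0 < t / x := div_pos ht hx
  have himage : (fun u => u * (t / x)) '' Ioo 0 x = Ioo 0 t := by
    rw [image_mul_right_Ioo _ _ hc, zero_mul, mul_div_cancel₀ _ hx.ne']
  have hd : ∀ u ∈ Ioo 0 x, HasDerivWithinAt (fun u => u * (t / x)) (1 * (t / x)) (Ioo 0 x) u :=
    fun u _ => ((hasDerivAt_id u).mul_const (t / x)).hasDerivWithinAt
  rw [← himage, lintegral_image_eq_lintegral_abs_deriv_mul measurableSet_Ioo hd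
    ((mul_left_injective₀ hc.ne').injOn)]
  simp [abs_of_pos hc]

/-- The iterated integral in the representation formula, written as a fractional average of the
Laplace transform of `ρ`. -/
theorem lintegral_exp_mul_rpow_mul_lintegral_Ioi (ρ : Measure ℝ) [SFinite ρ] (hρ : ρ (Iic 0) = 0)
    {lam x : ℝ} (hx : 0 < x) :
    ∫⁻ s in Ioi 0, ENNReal.ofReal (exp (-x * s) * s ^ (lam - 1)) *
        ∫⁻ t in Ioi s, ENNReal.ofReal (t ^ (-lam)) ∂ρ =
      ENNReal.ofReal (x ^ (-lam)) * ∫⁻ u in Ioo 0 x, ENNReal.ofReal (u ^ (lam - 1)) *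
        ∫⁻ t, ENNReal.ofReal (exp (-u * t)) ∂ρ := by
  set F : ℝ → ℝ → ENNReal := fun s t => (Ioi s).indicator
    (fun t => ENNReal.ofReal (exp (-x * s) * s ^ (lam - 1)) * ENNReal.ofReal (t ^ (-lam))) t
    with hF
  have hFm : Measurable (Function.uncurry F) := by
    have h1 : Function.uncurry F = {p : ℝ × ℝ | p.1 < p.2}.indicator (fun p =>
        ENNReal.ofReal (exp (-x * p.1) * p.1 ^ (lam - 1)) * ENNReal.ofReal (p.2 ^ (-lam))) := by
      ext p
      simp [Function.uncurry, hF, indicator]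
    rw [h1]
    exact Measurable.indicator (by fun_prop) (measurableSet_lt measurable_fst measurable_snd)
  have hinner : ∀ t, 0 < t → ∫⁻ s in Ioi 0, F s t = ENNReal.ofReal (x ^ (-lam)) *
      ∫⁻ u in Ioo 0 x, ENNReal.ofReal (u ^ (lam - 1)) * ENNReal.ofReal (exp (-u * t)) := by
    intro t ht
    have h1 : ∀ s, F s t = (Iio t).indicator (fun s =>
        ENNReal.ofReal (exp (-x * s) * s ^ (lam - 1)) * ENNReal.ofReal (t ^ (-lam))) s := by
      intro s
      simp [hF, indicator]
    simp_rw [h1]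
    rw [lintegral_indicator measurableSet_Iio, Measure.restrict_restrict measurableSet_Iio,
      inter_comm, Ioi_inter_Iio, lintegral_Ioo_comp_mul_right ht hx,
      ← lintegral_const_mul _ (by fun_prop)]
    refine setLIntegral_congr_fun measurableSet_Ioo fun u hu => ?_
    have hu0 := hu.1
    have hc : 0 < t / x := div_pos ht hx
    rw [← ENNReal.ofReal_mul (by positivity), ← ENNReal.ofReal_mul (by positivity),
      ← ENNReal.ofReal_mul (by positivity), ← ENNReal.ofReal_mul (by positivity)]
    congr 1
    rw [mul_rpow hu0.le hc.le, show -x * (u * (t / x)) = -u * t by field_simp,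
      rpow_sub_one hc.ne', div_rpow ht.le hx.le, rpow_neg ht.le, rpow_neg hx.le]
    have := (rpow_pos_of_pos ht lam).ne'
    field_simp
  have hswap : ∫⁻ s in Ioi 0, ENNReal.ofReal (exp (-x * s) * s ^ (lam - 1)) *
        ∫⁻ t in Ioi s, ENNReal.ofReal (t ^ (-lam)) ∂ρ = ∫⁻ s in Ioi 0, ∫⁻ t, F s t ∂ρ := by
    refine lintegral_congr fun s => ?_
    rw [← lintegral_const_mul _ (by fun_prop), ← lintegral_indicator measurableSet_Ioi]
  have hρ' : ∀ᵐ t ∂ρ, 0 < t := by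
    rw [ae_iff]; simpa [Iic] using hρ
  rw [hswap, lintegral_lintegral_swap hFm.aemeasurable,
    lintegral_congr_ae (hρ'.mono hinner), lintegral_const_mul _
      (Measurable.lintegral_prod_right' (f := fun p : ℝ × ℝ => ENNReal.ofReal (p.2 ^ (lam - 1)) *
        ENNReal.ofReal (exp (-p.2 * p.1))) (by fun_prop)),
    lintegral_lintegral_swap (by fun_prop)]
  congr 1
  refine lintegral_congr fun u => ?_
  dsimp only
  exact lintegral_const_mul _ (f := fun t => ENNReal.ofReal (exp (-u * t))) (by fun_prop)

theorem Antitone.lt_top_of_setLIntegral_mul_ne_top {K w : ℝ → ENNReal} (hK : Antitone K)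
    (hw : Measurable w) {b : ℝ} (hb : 0 < b) (hw0 : ∀ s ∈ Ioo 0 b, w s ≠ 0)
    (h : ∫⁻ s in Ioo 0 b, w s * K s ≠ ⊤) {s : ℝ} (hs : 0 < s) : K s < ⊤ := by
  by_contra hcon
  rw [not_lt_top_iff] at hcon
  have h1 : ∀ᵐ r ∂volume.restrict (Ioo 0 b), w r * K r < ⊤ :=
    ae_lt_top (hw.mul hK.measurable) h
  rw [ae_restrict_iff' measurableSet_Ioo] at h1
  have h2 : ∀ r ∈ Ioo 0 (min s b), ¬ (r ∈ Ioo 0 b → w r * K r < ⊤) := by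
    intro r hr hlt
    have hrb : r ∈ Ioo 0 b := ⟨hr.1, hr.2.trans_le (min_le_right _ _)⟩
    have hKr : K r = ⊤ := top_le_iff.1 (hcon ▸ hK (hr.2.trans_le (min_le_left _ _)).le)
    have := hlt hrb
    rw [hKr, ENNReal.mul_top (hw0 r hrb)] at this
    exact this.ne rfl
  have h3 : volume (Ioo 0 (min s b)) = 0 := measure_mono_null h2 (ae_iff.1 h1)
  rw [Real.volume_Ioo, sub_zero, ENNReal.ofReal_eq_zero] at h3
  exact (lt_min hs hb).not_ge h3

theorem hasDerivAt_rpow_mul {f : ℝ → ℝ} {lam x : ℝ} (hx : 0 < x) (hf : DifferentiableAt ℝ f x) :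
    HasDerivAt (fun x => x ^ lam * f x) (x ^ (lam - 1) * (lam * f x + x * deriv f x)) x := by
  refine ((hasDerivAt_rpow_const (Or.inl hx.ne')).fun_mul hf.hasDerivAt).congr_deriv ?_
  rw [rpow_sub_one hx.ne']
  field_simp

theorem exists_setLIntegral_rpow_mul_eq {lam : ℝ} {f : ℝ → ℝ}
    (hf : ContDiffOn ℝ (⊤ : ℕ∞) f (Ioi 0)) (hf0 : ∀ x, 0 < x → 0 ≤ f x)
    (hg0 : ∀ x, 0 < x → 0 ≤ lam * f x + x * deriv f x) :
    ∃ β, 0 ≤ β ∧ ∀ x, 0 < x → β ≤ x ^ lam * f x ∧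
      ∫⁻ u in Ioo 0 x, ENNReal.ofReal (u ^ (lam - 1)) * ENNReal.ofReal (lam * f u + u * deriv f u) =
        ENNReal.ofReal (x ^ lam * f x - β) := by
  set h : ℝ → ℝ := fun x => x ^ lam * f x with hh
  have hd : ∀ x, 0 < x → HasDerivAt h (x ^ (lam - 1) * (lam * f x + x * deriv f x)) x :=
    fun x hx => hasDerivAt_rpow_mul hx
      ((hf.differentiableOn (by simp)).differentiableAt (Ioi_mem_nhds hx))
  have hnonneg : ∀ x, 0 < x → 0 ≤ x ^ (lam - 1) * (lam * f x + x * deriv f x) := fun x hx =>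
    mul_nonneg (rpow_nonneg hx.le _) (hg0 x hx)
  have hmono : MonotoneOn h (Ioi 0) := by
    refine monotoneOn_of_deriv_nonneg (convex_Ioi 0)
      (fun x hx => (hd x hx).continuousAt.continuousWithinAt)
      (fun x hx => ?_) (fun x hx => ?_) <;> rw [interior_Ioi] at hx
    · exact (hd x hx).differentiableAt.differentiableWithinAt
    · rw [(hd x hx).deriv]
      exact hnonneg x hx
  have hbdd : BddBelow (h '' Ioi 0) := by
    refine ⟨0, ?_⟩
    rintro _ ⟨x, hx, rfl⟩
    exact mul_nonneg (rpow_nonneg (le_of_lt hx) _) (hf0 x hx)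
  have hlim := hmono.tendsto_nhdsGT hbdd
  set β := sInf (h '' Ioi 0)
  refine ⟨β, ?_, fun x hx => ⟨csInf_le hbdd ⟨x, hx, rfl⟩, ?_⟩⟩
  · refine le_csInf (nonempty_Ioi.image h) ?_
    rintro _ ⟨x, hx, rfl⟩
    exact mul_nonneg (rpow_nonneg (le_of_lt hx) _) (hf0 x hx)
  set k := Function.update h 0 β with hk
  have hkh : ∀ y, 0 < y → k y = h y := fun y hy => Function.update_of_ne hy.ne' _ _
  have hkd : ∀ y ∈ Ioo 0 x, HasDerivAt k (y ^ (lam - 1) * (lam * f y + y * deriv f y)) y := by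
    intro y hy
    refine (hd y hy.1).congr_of_eventuallyEq ?_
    filter_upwards [Ioi_mem_nhds hy.1] with z hz using hkh z hz
  have hkc : ContinuousOn k (Icc 0 x) := by
    intro y hy
    rcases hy.1.eq_or_lt with rfl | hy0
    · have h1 : ContinuousWithinAt k (Ioi 0) 0 := by
        rw [continuousWithinAt_update_same.trans (by simp : _ ↔ Tendsto h (𝓝[Ioi 0 \ {0}] 0) (𝓝 β))]
        rw [sdiff_singleton_eq_self (by simp)]
        exact hlim
      exact (continuousWithinAt_insert_self.2 h1).mono (by
        rw [Ioi_insert]; exact Icc_subset_Ici_self)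
    · refine ContinuousAt.continuousWithinAt ?_
      refine (hd y hy0).continuousAt.congr ?_
      filter_upwards [Ioi_mem_nhds hy0] with z hz using (hkh z hz).symm
  have hfint := intervalIntegral.integrableOn_deriv_of_nonneg hkc hkd fun y hy => hnonneg y hy.1
  have hFTC := intervalIntegral.integral_eq_sub_of_hasDerivAt_of_le hx.le hkc hkd
    ((intervalIntegrable_iff_integrableOn_Ioc_of_le hx.le).2 hfint)
  rw [intervalIntegral.integral_of_le hx.le, hkh x hx, hk, Function.update_self] at hFTC
  change _ = ENNReal.ofReal (h x - β)
  rw [← hFTC, ofReal_integral_eq_lintegral_ofReal hfint, restrict_Ioo_eq_restrict_Ioc]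
  · refine setLIntegral_congr_fun measurableSet_Ioc fun u hu => ?_
    exact (ENNReal.ofReal_mul (rpow_nonneg hu.1.le _)).symm
  · exact (ae_restrict_iff' measurableSet_Ioc).2 (.of_forall fun u hu => hnonneg u hu.1)

theorem setLIntegral_Ioo_rpow {lam x : ℝ} (hlam : 0 < lam) (hx : 0 < x) :
    ∫⁻ u in Ioo 0 x, ENNReal.ofReal (u ^ (lam - 1)) = ENNReal.ofReal (x ^ lam / lam) := by
  have h1 := integral_rpow (a := 0) (b := x) (r := lam - 1) (Or.inl (by linarith))
  rw [sub_add_cancel, zero_rpow hlam.ne', sub_zero, intervalIntegral.integral_of_le hx.le] at h1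
  rw [← h1, restrict_Ioo_eq_restrict_Ioc, ofReal_integral_eq_lintegral_ofReal]
  · exact (intervalIntegrable_iff_integrableOn_Ioc_of_le hx.le).1
      (intervalIntegral.intervalIntegrable_rpow' (by linarith))
  · exact (ae_restrict_iff' measurableSet_Ioc).2 (.of_forall fun u hu => rpow_nonneg hu.1.le _)

theorem antitone_setLIntegral_Ioi (ρ : Measure ℝ) (w : ℝ → ENNReal) :
    Antitone fun s => ∫⁻ t in Ioi s, w t ∂ρ :=
  fun _ _ h => lintegral_mono_set (Ioi_subset_Ioi h)

theorem integrable_of_lintegral_exp_mul_rpow_ne_top {ρ : Measure ℝ} {lam x : ℝ}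
    (hJ : ∫⁻ s in Ioi 0, ENNReal.ofReal (exp (-x * s) * s ^ (lam - 1)) *
        ∫⁻ t in Ioi s, ENNReal.ofReal (t ^ (-lam)) ∂ρ ≠ ⊤) :
    (∀ s, 0 < s → IntegrableOn (fun t => t ^ (-lam)) (Ioi s) ρ) ∧
    IntegrableOn (fun s => exp (-x * s) * s ^ (lam - 1) * ∫ t in Ioi s, t ^ (-lam) ∂ρ) (Ioi 0) ∧
    ∫ s in Ioi 0, exp (-x * s) * s ^ (lam - 1) * ∫ t in Ioi s, t ^ (-lam) ∂ρ =
      (∫⁻ s in Ioi 0, ENNReal.ofReal (exp (-x * s) * s ^ (lam - 1)) *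
        ∫⁻ t in Ioi s, ENNReal.ofReal (t ^ (-lam)) ∂ρ).toReal := by
  have hK := antitone_setLIntegral_Ioi ρ fun t => ENNReal.ofReal (t ^ (-lam))
  have hKfin : ∀ s, 0 < s → ∫⁻ t in Ioi s, ENNReal.ofReal (t ^ (-lam)) ∂ρ < ⊤ := by
    intro s hs
    refine hK.lt_top_of_setLIntegral_mul_ne_top
      (w := fun s => ENNReal.ofReal (exp (-x * s) * s ^ (lam - 1))) (by fun_prop) one_pos
      (fun s hs => ?_) (ne_top_of_le_ne_top hJ (lintegral_mono_set Ioo_subset_Ioi_self)) hs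
    have := hs.1
    simp only [ne_eq, ENNReal.ofReal_eq_zero, not_le]
    positivity
  have hnn : ∀ s, 0 < s → ∀ᵐ t ∂ρ.restrict (Ioi s), 0 ≤ t ^ (-lam) := fun s hs =>
    (ae_restrict_iff' measurableSet_Ioi).2 (.of_forall fun t ht =>
      rpow_nonneg (hs.trans ht).le _)
  have hfint : ∀ s, 0 < s → IntegrableOn (fun t => t ^ (-lam)) (Ioi s) ρ := fun s hs =>
    ⟨by fun_prop, (hasFiniteIntegral_iff_ofReal (hnn s hs)).2 (hKfin s hs)⟩
  have heq : EqOn (fun s => (ENNReal.ofReal (exp (-x * s) * s ^ (lam - 1)) *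
        ∫⁻ t in Ioi s, ENNReal.ofReal (t ^ (-lam)) ∂ρ).toReal)
      (fun s => exp (-x * s) * s ^ (lam - 1) * ∫ t in Ioi s, t ^ (-lam) ∂ρ) (Ioi 0) := by
    intro s hs
    have hs' : 0 < s := hs
    dsimp only
    rw [ENNReal.toReal_mul, ENNReal.toReal_ofReal (by positivity),
      integral_eq_lintegral_of_nonneg_ae (hnn s hs) (by fun_prop)]
  have hmeas : AEMeasurable (fun s => ENNReal.ofReal (exp (-x * s) * s ^ (lam - 1)) *
        ∫⁻ t in Ioi s, ENNReal.ofReal (t ^ (-lam)) ∂ρ) (volume.restrict (Ioi 0)) :=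
    (Measurable.mul (by fun_prop) hK.measurable).aemeasurable
  refine ⟨hfint, ?_, ?_⟩
  · exact (integrableOn_congr_fun heq measurableSet_Ioi).1
      (integrable_toReal_of_lintegral_ne_top hmeas hJ)
  · rw [← setIntegral_congr_fun measurableSet_Ioi heq, integral_toReal hmeas (ae_lt_top' hmeas hJ)]

theorem exists_representation_of_completelyMonotonic {lam : ℝ} (hlam : 0 < lam) {f : ℝ → ℝ}
    (hf : ContDiffOn ℝ (⊤ : ℕ∞) f (Ioi 0)) (hf0 : ∀ x, 0 < x → 0 ≤ f x)
    (hg : CompletelyMonotonic fun x => lam * f x + x * deriv f x) :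
    ∃ α β : ℝ, 0 ≤ α ∧ 0 ≤ β ∧ ∃ μ : Measure ℝ,
      (∀ s : ℝ, 0 < s → IntegrableOn (fun t => t ^ (-lam)) (Ioi s) μ) ∧
      (∀ x : ℝ, 0 < x → IntegrableOn
          (fun s => exp (-x * s) * s ^ (lam - 1) * ∫ t in Ioi s, t ^ (-lam) ∂μ) (Ioi 0)) ∧
      (∀ x : ℝ, 0 < x → f x = α + β * x ^ (-lam) +
          ∫ s in Ioi 0, exp (-x * s) * s ^ (lam - 1) * ∫ t in Ioi s, t ^ (-lam) ∂μ) := by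
  have hg0 : ∀ x, 0 < x → 0 ≤ lam * f x + x * deriv f x := fun x hx => by
    simpa using hg.2 0 x hx
  obtain ⟨β, hβ, hβf⟩ := exists_setLIntegral_rpow_mul_eq hf hf0 hg0
  obtain ⟨ν, hνs, hν0, hν⟩ := hg.exists_measure_lintegral_exp_eq
  set ρ := ν.restrict (Ioi 0) with hρ
  have hρ0 : ρ (Iic 0) = 0 := by
    rw [hρ, Measure.restrict_apply measurableSet_Iic, Iic_inter_Ioi, Ioc_self, measure_empty]
  have hsplit : ∀ x, ∫⁻ t, ENNReal.ofReal (exp (-x * t)) ∂ν =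
      ν {0} + ∫⁻ t, ENNReal.ofReal (exp (-x * t)) ∂ρ := by
    intro x
    rw [← lintegral_add_compl _ (measurableSet_Ioi (a := (0 : ℝ))), add_comm, compl_Ioi,
      ← Iio_union_right, lintegral_union (measurableSet_singleton 0) (by simp),
      setLIntegral_measure_zero _ _ hν0, zero_add, lintegral_singleton, mul_zero,
      exp_zero, ENNReal.ofReal_one, one_mul]
  have ha : ν {0} ≠ ⊤ := by
    refine ne_top_of_le_ne_top (b := ENNReal.ofReal (lam * f 1 + 1 * deriv f 1))
      ENNReal.ofReal_ne_top ?_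
    rw [← hν 1 one_pos, hsplit]
    exact le_self_add
  set J : ℝ → ENNReal := fun x => ∫⁻ s in Ioi 0, ENNReal.ofReal (exp (-x * s) * s ^ (lam - 1)) *
        ∫⁻ t in Ioi s, ENNReal.ofReal (t ^ (-lam)) ∂ρ with hJ
  have hmain : ∀ x, 0 < x →
      ENNReal.ofReal (f x - β * x ^ (-lam)) = ν {0} * ENNReal.ofReal lam⁻¹ + J x := by
    intro x hx
    have h1 := (hβf x hx).2
    have h2 : ∀ u ∈ Ioo 0 x, ENNReal.ofReal (u ^ (lam - 1)) *
        ENNReal.ofReal (lam * f u + u * deriv f u) = ν {0} * ENNReal.ofReal (u ^ (lam - 1)) +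
          ENNReal.ofReal (u ^ (lam - 1)) * ∫⁻ t, ENNReal.ofReal (exp (-u * t)) ∂ρ := by
      intro u hu
      rw [← hν u hu.1, hsplit, mul_add, mul_comm (ν {0})]
    rw [setLIntegral_congr_fun measurableSet_Ioo h2, lintegral_add_left (by fun_prop),
      lintegral_const_mul _ (by fun_prop), setLIntegral_Ioo_rpow hlam hx] at h1
    have hxl := rpow_pos_of_pos hx lam
    rw [hJ]
    dsimp only
    rw [lintegral_exp_mul_rpow_mul_lintegral_Ioi ρ hρ0 hx,
      show f x - β * x ^ (-lam) = x ^ (-lam) * (x ^ lam * f x - β) by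
        rw [rpow_neg hx.le]; field_simp,
      ENNReal.ofReal_mul (rpow_nonneg hx.le _), ← h1, mul_add, mul_left_comm,
      ← ENNReal.ofReal_mul (rpow_nonneg hx.le _)]
    congr 4
    rw [rpow_neg hx.le]
    field_simp
  have hJfin : ∀ x, 0 < x → J x ≠ ⊤ := fun x hx =>
    ne_top_of_le_ne_top (ENNReal.ofReal_ne_top) ((hmain x hx).symm ▸ le_add_self)
  have key := fun x hx => integrable_of_lintegral_exp_mul_rpow_ne_top (hJfin x hx)
  refine ⟨(ν {0}).toReal * lam⁻¹, β, by positivity, hβ, ρ, (key 1 one_pos).1,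
    fun x hx => (key x hx).2.1, fun x hx => ?_⟩
  rw [(key x hx).2.2]
  have h1 := congrArg ENNReal.toReal (hmain x hx)
  have h2 : 0 ≤ f x - β * x ^ (-lam) := by
    have h3 := (hβf x hx).1
    rw [rpow_neg hx.le, sub_nonneg, ← div_eq_mul_inv, div_le_iff₀ (rpow_pos_of_pos hx lam)]
    linarith
  rw [ENNReal.toReal_ofReal h2, ENNReal.toReal_add (ENNReal.mul_ne_top ha ENNReal.ofReal_ne_top)
    (hJfin x hx), ENNReal.toReal_mul, ENNReal.toReal_ofReal (by positivity)] at h1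
  linarith

theorem CompletelyMonotonic.congr {g h : ℝ → ℝ} (hg : CompletelyMonotonic g)
    (hgh : EqOn h g (Ioi 0)) :
    CompletelyMonotonic h :=
  ⟨hg.1.congr hgh, fun n x hx => by
    rw [iteratedDerivWithin_congr hgh hx]
    exact hg.2 n x hx⟩

/-- Laplace transforms of measures on `[0, ∞)` are completely monotonic. -/
theorem completelyMonotonic_mgf_neg {μ : Measure ℝ} (hμ : μ (Iio 0) = 0)
    (hfint : ∀ x, 0 < x → Integrable (fun t => exp (-x * t)) μ) :
    CompletelyMonotonic fun x => mgf id μ (-x) := by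
  have hmem : ∀ x, 0 < x → -x ∈ interior (integrableExpSet id μ) := by
    intro x hx
    refine mem_interior.2 ⟨Iio 0, fun y hy => ?_, isOpen_Iio, neg_lt_zero.2 hx⟩
    have := hfint (-y) (neg_pos.2 hy)
    rwa [neg_neg] at this
  refine ⟨?_, fun n x hx => ?_⟩
  · exact (analyticOnNhd_mgf.contDiffOn isOpen_interior.uniqueDiffOn).comp
      contDiff_neg.contDiffOn hmem
  · rw [iteratedDerivWithin_of_isOpen isOpen_Ioi hx, iteratedDeriv_comp_neg,
      iteratedDeriv_mgf (hmem x hx), smul_eq_mul, ← mul_assoc, ← mul_pow]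
    norm_num
    refine integral_nonneg_of_ae ?_
    have hμ' : ∀ᵐ t ∂μ, 0 ≤ t := by
      rw [ae_iff]
      simpa [Iio] using hμ
    filter_upwards [hμ'] with t ht
    simp only [Pi.zero_apply]
    positivity

theorem sigmaFinite_restrict_Ioi_of_integrableOn_rpow {μ : Measure ℝ} {r : ℝ}
    (h : ∀ s, 0 < s → IntegrableOn (fun t => t ^ r) (Ioi s) μ) :
    SigmaFinite (μ.restrict (Ioi 0)) := by
  refine ⟨⟨⟨fun n => Iic 0 ∪ {t | 1 / ((n : ℝ) + 1) < t ∧ 1 / ((n : ℝ) + 1) ≤ t ^ r},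
    fun _ => trivial, fun n => measure_union_lt_top ?_ ?_, ?_⟩⟩⟩
  · rw [Measure.restrict_apply measurableSet_Iic, Iic_inter_Ioi, Ioc_self, measure_empty]
    exact ENNReal.zero_lt_top
  · have hn : 0 < 1 / ((n : ℝ) + 1) := by positivity
    refine ((Measure.restrict_apply_le _ _).trans_lt ?_)
    have h1 := (h _ hn).measure_norm_ge_lt_top hn
    rw [Measure.restrict_apply' measurableSet_Ioi] at h1
    exact (measure_mono fun t ht => And.intro (ht.2.trans (le_abs_self _)) ht.1).trans_lt h1
  · refine eq_univ_of_forall fun t => mem_iUnion.2 ?_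
    rcases le_or_gt t 0 with ht | ht
    · exact ⟨0, Or.inl ht⟩
    · obtain ⟨n, hn⟩ := exists_nat_one_div_lt (lt_min ht (rpow_pos_of_pos ht r))
      exact ⟨n, Or.inr ⟨hn.trans_le (min_le_left _ _), (hn.trans_le (min_le_right _ _)).le⟩⟩

theorem completelyMonotonic_of_representation {lam : ℝ} (hlam : 0 < lam) {f : ℝ → ℝ}
    (hf : ContDiffOn ℝ (⊤ : ℕ∞) f (Ioi 0)) {α β : ℝ} (hα : 0 ≤ α) {μ : Measure ℝ}
    (hμ : ∀ s : ℝ, 0 < s → IntegrableOn (fun t => t ^ (-lam)) (Ioi s) μ)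
    (hfint : ∀ x : ℝ, 0 < x → IntegrableOn
      (fun s => exp (-x * s) * s ^ (lam - 1) * ∫ t in Ioi s, t ^ (-lam) ∂μ) (Ioi 0))
    (hrep : ∀ x : ℝ, 0 < x → f x = α + β * x ^ (-lam) +
      ∫ s in Ioi 0, exp (-x * s) * s ^ (lam - 1) * ∫ t in Ioi s, t ^ (-lam) ∂μ) :
    CompletelyMonotonic (fun x => lam * f x + x * deriv f x) := by
  have hσ := sigmaFinite_restrict_Ioi_of_integrableOn_rpow hμ
  set ρ := μ.restrict (Ioi 0) with hρ
  have hρ0 : ρ (Iic 0) = 0 := by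
    rw [hρ, Measure.restrict_apply measurableSet_Iic, Iic_inter_Ioi, Ioc_self, measure_empty]
  have hρs : ∀ s, 0 < s → ρ.restrict (Ioi s) = μ.restrict (Ioi s) := fun s hs => by
    rw [hρ, Measure.restrict_restrict measurableSet_Ioi, Ioi_inter_Ioi, max_eq_left hs.le]
  have hK : ∀ s, 0 < s → ∫⁻ t in Ioi s, ENNReal.ofReal (t ^ (-lam)) ∂ρ =
      ENNReal.ofReal (∫ t in Ioi s, t ^ (-lam) ∂μ) := fun s hs => by
    rw [hρs s hs, ofReal_integral_eq_lintegral_ofReal (hμ s hs)]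
    exact (ae_restrict_iff' measurableSet_Ioi).2 (.of_forall fun t ht =>
      rpow_nonneg (hs.trans ht).le _)
  have hnn : ∀ x s : ℝ, 0 < s →
      0 ≤ exp (-x * s) * s ^ (lam - 1) * ∫ t in Ioi s, t ^ (-lam) ∂μ := fun x s hs =>
    mul_nonneg (by positivity) (setIntegral_nonneg measurableSet_Ioi fun t ht =>
      rpow_nonneg (hs.trans ht).le _)
  have hJ : ∀ x, 0 < x → ∫⁻ s in Ioi 0, ENNReal.ofReal (exp (-x * s) * s ^ (lam - 1)) *
        ∫⁻ t in Ioi s, ENNReal.ofReal (t ^ (-lam)) ∂ρ =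
      ENNReal.ofReal (f x - α - β * x ^ (-lam)) := by
    intro x hx
    rw [hrep x hx, show ∀ a b c : ℝ, a + b + c - a - b = c by intros; ring,
      ofReal_integral_eq_lintegral_ofReal (hfint x hx)
        ((ae_restrict_iff' measurableSet_Ioi).2 (.of_forall (hnn x)))]
    refine setLIntegral_congr_fun measurableSet_Ioi fun s hs => ?_
    have hs' : 0 < s := hs
    rw [hK s hs, ENNReal.ofReal_mul (p := exp (-x * s) * s ^ (lam - 1)) (by positivity)]
  have hJ0 : ∀ x, 0 < x → 0 ≤ f x - α - β * x ^ (-lam) := by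
    intro x hx
    rw [hrep x hx, show ∀ a b c : ℝ, a + b + c - a - b = c by intros; ring]
    exact setIntegral_nonneg measurableSet_Ioi (hnn x)
  set L : ℝ → ENNReal := fun u => ∫⁻ t, ENNReal.ofReal (exp (-u * t)) ∂ρ with hL
  have hρ' : ∀ᵐ t ∂ρ, 0 < t := ae_restrict_mem measurableSet_Ioi
  have hLanti : Antitone L := by
    intro u v huv
    refine lintegral_mono_ae ?_
    filter_upwards [hρ'] with t ht
    gcongr
  have hI : ∀ x, 0 < x → ∫⁻ u in Ioo 0 x, ENNReal.ofReal (u ^ (lam - 1)) * L u =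
      ENNReal.ofReal (x ^ lam * f x - α * x ^ lam - β) := by
    intro x hx
    have h1 := (lintegral_exp_mul_rpow_mul_lintegral_Ioi ρ hρ0 hx).symm.trans (hJ x hx)
    have hxl := rpow_pos_of_pos hx lam
    have h2 : x ^ lam * f x - α * x ^ lam - β = x ^ lam * (f x - α - β * x ^ (-lam)) := by
      rw [rpow_neg hx.le]; field_simp
    rw [h2, ENNReal.ofReal_mul hxl.le, ← h1, ← mul_assoc, ← ENNReal.ofReal_mul hxl.le,
      ← rpow_add hx, add_neg_cancel, rpow_zero, ENNReal.ofReal_one, one_mul]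
  have hLfin : ∀ u, 0 < u → L u < ⊤ := fun u hu =>
    hLanti.lt_top_of_setLIntegral_mul_ne_top (w := fun u => ENNReal.ofReal (u ^ (lam - 1)))
      (by fun_prop) one_pos (fun s hs => by
        simpa using rpow_pos_of_pos hs.1 _) (by rw [hI 1 one_pos]; exact ENNReal.ofReal_ne_top) hu
  have hexp : ∀ u, 0 < u → Integrable (fun t => exp (-u * t)) ρ := fun u hu =>
    ⟨by fun_prop, (hasFiniteIntegral_iff_ofReal (.of_forall fun t => (exp_pos _).le)).2
      (hLfin u hu)⟩
  have hLmgf : ∀ u, (L u).toReal = mgf id ρ (-u) := fun u => by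
    rw [mgf, integral_eq_lintegral_of_nonneg_ae (.of_forall fun t => (exp_pos _).le) (by fun_prop)]
    rfl
  have hM := completelyMonotonic_mgf_neg (measure_mono_null Iio_subset_Iic_self hρ0) hexp
  have hLm : Measurable L := hLanti.measurable
  have hIx : ∀ x, 0 < x → IntervalIntegrable (fun u => u ^ (lam - 1) * mgf id ρ (-u)) volume 0 x ∧
      ∫ u in 0..x, u ^ (lam - 1) * mgf id ρ (-u) = x ^ lam * f x - α * x ^ lam - β := by
    intro x hx
    have hmeas : AEMeasurable (fun u => ENNReal.ofReal (u ^ (lam - 1)) * L u)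
      (volume.restrict (Ioo 0 x)) := (Measurable.mul (by fun_prop) hLm).aemeasurable
    have hfin : ∫⁻ u in Ioo 0 x, ENNReal.ofReal (u ^ (lam - 1)) * L u ≠ ⊤ := by
      rw [hI x hx]; exact ENNReal.ofReal_ne_top
    have heq : EqOn (fun u => (ENNReal.ofReal (u ^ (lam - 1)) * L u).toReal)
        (fun u => u ^ (lam - 1) * mgf id ρ (-u)) (Ioo 0 x) := fun u hu => by
      simp only [ENNReal.toReal_mul, ENNReal.toReal_ofReal (rpow_nonneg hu.1.le _), hLmgf]
    constructor
    · rw [intervalIntegrable_iff_integrableOn_Ioo_of_le hx.le,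
        ← integrableOn_congr_fun heq measurableSet_Ioo]
      exact integrable_toReal_of_lintegral_ne_top hmeas hfin
    · have hxl := rpow_pos_of_pos hx lam
      have h2 : x ^ lam * f x - α * x ^ lam - β = x ^ lam * (f x - α - β * x ^ (-lam)) := by
        rw [rpow_neg hx.le]; field_simp
      rw [intervalIntegral.integral_of_le hx.le, integral_Ioc_eq_integral_Ioo,
        ← setIntegral_congr_fun measurableSet_Ioo heq,
        integral_toReal hmeas (ae_lt_top' hmeas hfin), hI x hx, ENNReal.toReal_ofReal]
      exact h2 ▸ mul_nonneg hxl.le (hJ0 x hx)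
  have hcont : ContinuousOn (fun u => u ^ (lam - 1) * mgf id ρ (-u)) (Ioi 0) := fun u hu =>
    (continuousAt_rpow_const _ _ (Or.inl (ne_of_gt hu))).continuousWithinAt.mul
      (hM.1.continuousOn u hu)
  have hderiv : ∀ x, 0 < x → lam * f x + x * deriv f x = α * lam + mgf id ρ (-x) := by
    intro x hx
    have hd1 := hasDerivAt_rpow_mul (lam := lam) hx
      ((hf.differentiableOn (by simp)).differentiableAt (Ioi_mem_nhds hx))
    have hd2 := intervalIntegral.integral_hasDerivAt_right (hIx x hx).1
      (hcont.stronglyMeasurableAtFilter isOpen_Ioi x hx) (hcont.continuousAt (Ioi_mem_nhds hx))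
    have hd3 := (((hasDerivAt_rpow_const (p := lam) (Or.inl hx.ne')).const_mul α).add_const
      β).fun_add hd2
    have hev : (fun x => x ^ lam * f x) =ᶠ[𝓝 x]
        fun y => α * y ^ lam + β + ∫ u in 0..y, u ^ (lam - 1) * mgf id ρ (-u) := by
      filter_upwards [Ioi_mem_nhds hx] with y hy
      rw [(hIx y hy).2]
      ring
    have h := hd1.unique (hd3.congr_of_eventuallyEq hev)
    have hxl := rpow_pos_of_pos hx (lam - 1)
    refine mul_left_cancel₀ hxl.ne' (h.trans ?_)
    ring
  have hc : 0 ≤ α * lam := mul_nonneg hα hlam.le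
  set c := ENNReal.ofReal (α * lam) with hcdef
  have hdirac : ∀ x : ℝ, Integrable (fun t => exp (-x * t)) (c • Measure.dirac (0 : ℝ)) := fun x =>
    (integrable_dirac (by simp)).smul_measure ENNReal.ofReal_ne_top
  refine (completelyMonotonic_mgf_neg (μ := ρ + c • Measure.dirac 0) ?_
    fun x hx => (hexp x hx).add_measure (hdirac x)).congr fun x hx => ?_
  · simp [measure_mono_null Iio_subset_Iic_self hρ0]
  · rw [hderiv x hx]
    simp only [mgf, id]
    rw [integral_add_measure (hexp x hx) (hdirac x), integral_smul_measure, integral_dirac, hcdef,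
      ENNReal.toReal_ofReal hc, mul_zero, exp_zero, smul_eq_mul, mul_one, add_comm]

end

theorem cor_bernstein (lam : ℝ) (hlam : 0 < lam) (f : ℝ → ℝ)
    (hf : ContDiffOn ℝ (⊤ : ℕ∞) f (Set.Ioi 0)) (hf0 : ∀ x : ℝ, 0 < x → 0 ≤ f x) :
    CompletelyMonotonic (fun x => lam * f x + x * deriv f x)
    ↔
    ∃ α β : ℝ, 0 ≤ α ∧ 0 ≤ β ∧ ∃ μ : Measure ℝ,
      (∀ s : ℝ, 0 < s → IntegrableOn (fun t => t ^ (-lam)) (Set.Ioi s) μ) ∧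
      (∀ x : ℝ, 0 < x →
        IntegrableOn
          (fun s => Real.exp (-x * s) * s ^ (lam - 1) * ∫ t in Set.Ioi s, t ^ (-lam) ∂μ)
          (Set.Ioi 0)) ∧
      (∀ x : ℝ, 0 < x →
        f x = α + β * x ^ (-lam) +
          ∫ s in Set.Ioi 0,
            Real.exp (-x * s) * s ^ (lam - 1) * ∫ t in Set.Ioi s, t ^ (-lam) ∂μ) := by
  constructor
  · exact exists_representation_of_completelyMonotonic hlam hf hf0
  · rintro ⟨α, β, hα, -, μ, hμ, hfint, hrep⟩
    exact completelyMonotonic_of_representation hlam hf hα hμ hfint hrep
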